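/- arXiv:1809.00816 — 9 statements merged into one kernel-verified Lean document; each statement's English description precedes it below -/
import Mathlib

section
/- Let n ≥ 1 and λ ≥ 1. Let φ : S^{n-1} → S^{n-1} be a bijection of the unit sphere which is λ-bi-Lipschitz with respect to the Euclidean (chordal) distance, i.e. λ⁻¹‖x−y‖ ≤ ‖φ(x)−φ(y)‖ ≤ λ‖x−y‖ for all x,y ∈ S^{n-1}. Then its radial extension φ̃ : ℝ^n → ℝ^n is (λ+1)-bi-Lipschitz: (λ+1)⁻¹‖v−w‖ ≤ ‖φ̃(v)−φ̃(w)‖ ≤ (λ+1)‖v−w‖ for all v,w ∈ ℝ^n. -/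
open Metric Classical

/-- The radial extension of a self-map of the unit sphere of `ℝⁿ`:
`φ̃(v) = ‖v‖ • φ(v/‖v‖)` for `v ≠ 0` and `φ̃(0) = 0`. -/
noncomputable def radialExt {n : ℕ}
    (φ : sphere (0 : EuclideanSpace ℝ (Fin n)) 1 → sphere (0 : EuclideanSpace ℝ (Fin n)) 1)
    (v : EuclideanSpace ℝ (Fin n)) : EuclideanSpace ℝ (Fin n) :=
  if h : v = 0 then 0
  else ‖v‖ • (φ ⟨‖v‖⁻¹ • v, by
    rw [mem_sphere_zero_iff_norm, norm_smul, norm_inv, norm_norm,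
      inv_mul_cancel₀ (norm_ne_zero_iff.mpr h)]⟩ : EuclideanSpace ℝ (Fin n))

/-- Distance of rescaled unit vectors in terms of the scales and the chordal distance. -/
theorem norm_smul_sub_smul_sq_of_norm_eq_one {E : Type*} [NormedAddCommGroup E]
    [InnerProductSpace ℝ E] {x y : E} (hx : ‖x‖ = 1) (hy : ‖y‖ = 1) (a b : ℝ) :
    ‖a • x - b • y‖ ^ 2 = (a - b) ^ 2 + a * b * ‖x - y‖ ^ 2 := by
  rw [norm_sub_sq_real, norm_sub_sq_real, norm_smul, norm_smul, real_inner_smul_left,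
    real_inner_smul_right, hx, hy, mul_one, mul_one, Real.norm_eq_abs, Real.norm_eq_abs,
    sq_abs, sq_abs]
  ring

/-- An expansion bound `L ≥ 1` between unit vectors persists after rescaling. -/
theorem norm_smul_sub_smul_le_of_norm_eq_one {E F : Type*} [NormedAddCommGroup E]
    [InnerProductSpace ℝ E] [NormedAddCommGroup F] [InnerProductSpace ℝ F] {x y : E} {p q : F}
    (hx : ‖x‖ = 1) (hy : ‖y‖ = 1) (hp : ‖p‖ = 1) (hq : ‖q‖ = 1) {a b L : ℝ}
    (ha : 0 ≤ a) (hb : 0 ≤ b) (hL : 1 ≤ L) (h : ‖p - q‖ ≤ L * ‖x - y‖) :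
    ‖a • p - b • q‖ ≤ L * ‖a • x - b • y‖ := by
  refine (sq_le_sq₀ (by positivity) (by positivity)).mp ?_
  rw [mul_pow, norm_smul_sub_smul_sq_of_norm_eq_one hx hy,
    norm_smul_sub_smul_sq_of_norm_eq_one hp hq, mul_add]
  have hsq : ‖p - q‖ ^ 2 ≤ L ^ 2 * ‖x - y‖ ^ 2 := by
    rw [← mul_pow]
    gcongr
  have hab : a * b * ‖p - q‖ ^ 2 ≤ a * b * (L ^ 2 * ‖x - y‖ ^ 2) := by gcongr
  have hL2 : (a - b) ^ 2 ≤ L ^ 2 * (a - b) ^ 2 :=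
    le_mul_of_one_le_left (sq_nonneg _) (one_le_pow₀ hL)
  linarith

/-- Polar decomposition of `v` and of its image under the radial extension. -/
theorem exists_eq_smul_and_radialExt_eq_smul {n : ℕ} (hn : 1 ≤ n)
    (φ : sphere (0 : EuclideanSpace ℝ (Fin n)) 1 → sphere (0 : EuclideanSpace ℝ (Fin n)) 1)
    (v : EuclideanSpace ℝ (Fin n)) :
    ∃ x : sphere (0 : EuclideanSpace ℝ (Fin n)) 1,
      v = ‖v‖ • (x : EuclideanSpace ℝ (Fin n)) ∧
        radialExt φ v = ‖v‖ • (φ x : EuclideanSpace ℝ (Fin n)) := by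
  by_cases h : v = 0
  · exact ⟨⟨EuclideanSpace.single ⟨0, hn⟩ 1, by simp⟩, by simp [h], by simp [radialExt, h]⟩
  · refine ⟨⟨‖v‖⁻¹ • v, ?_⟩, ?_, ?_⟩
    · rw [mem_sphere_zero_iff_norm, norm_smul, norm_inv, norm_norm,
        inv_mul_cancel₀ (norm_ne_zero_iff.mpr h)]
    · exact (smul_inv_smul₀ (norm_ne_zero_iff.mpr h) v).symm
    · rw [radialExt, dif_neg h]

theorem radialExt_biLipschitz {n : ℕ} (hn : 1 ≤ n) (lam : ℝ) (hlam : 1 ≤ lam)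
    (φ : sphere (0 : EuclideanSpace ℝ (Fin n)) 1 → sphere (0 : EuclideanSpace ℝ (Fin n)) 1)
    (hbij : Function.Bijective φ)
    (hlow : ∀ x y : sphere (0 : EuclideanSpace ℝ (Fin n)) 1,
      lam⁻¹ * ‖(x : EuclideanSpace ℝ (Fin n)) - (y : EuclideanSpace ℝ (Fin n))‖ ≤
        ‖(φ x : EuclideanSpace ℝ (Fin n)) - (φ y : EuclideanSpace ℝ (Fin n))‖)
    (hup : ∀ x y : sphere (0 : EuclideanSpace ℝ (Fin n)) 1,
      ‖(φ x : EuclideanSpace ℝ (Fin n)) - (φ y : EuclideanSpace ℝ (Fin n))‖ ≤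
        lam * ‖(x : EuclideanSpace ℝ (Fin n)) - (y : EuclideanSpace ℝ (Fin n))‖) :
    ∀ v w : EuclideanSpace ℝ (Fin n),
      (lam + 1)⁻¹ * ‖v - w‖ ≤ ‖radialExt φ v - radialExt φ w‖ ∧
        ‖radialExt φ v - radialExt φ w‖ ≤ (lam + 1) * ‖v - w‖ := by
  intro v w
  obtain ⟨x, hv, hφv⟩ := exists_eq_smul_and_radialExt_eq_smul hn φ v
  obtain ⟨y, hw, hφw⟩ := exists_eq_smul_and_radialExt_eq_smul hn φ w
  have unit (z : sphere (0 : EuclideanSpace ℝ (Fin n)) 1) :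
      ‖(z : EuclideanSpace ℝ (Fin n))‖ = 1 := norm_eq_of_mem_sphere z
  have hpos : 0 < lam := by linarith
  have upper := norm_smul_sub_smul_le_of_norm_eq_one (unit x) (unit y) (unit (φ x)) (unit (φ y))
    (norm_nonneg v) (norm_nonneg w) hlam (hup x y)
  have lower := norm_smul_sub_smul_le_of_norm_eq_one (unit (φ x)) (unit (φ y)) (unit x) (unit y)
    (norm_nonneg v) (norm_nonneg w) hlam ((inv_mul_le_iff₀ hpos).mp (hlow x y))
  rw [← hφv, ← hφw, ← hv, ← hw] at upper lower
  have hle : lam ≤ lam + 1 := by linarith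
  exact ⟨(inv_mul_le_iff₀ (by linarith)).mpr (lower.trans (by gcongr)),
    upper.trans (by gcongr)⟩
end

section
/- Let n ≥ 1 and let φ, ψ : S^{n-1} → S^{n-1} be maps with φ ≠ ψ. Then their radial extensions are at unbounded distance from each other: for every N > 0 there exists v ∈ ℝ^n with ‖φ̃(v) − ψ̃(v)‖ > N. (This is the injectivity of the map φ ↦ [φ̃] from bi-Lipschitz homeomorphisms of the sphere into the quasi-isometry group of ℝ^n.) -/
open Metric Classical

/-- On the ray through a point `x` of the sphere, the radial extension is linear. -/
theorem radialExt_smul_of_pos {n : ℕ}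
    (φ : sphere (0 : EuclideanSpace ℝ (Fin n)) 1 → sphere (0 : EuclideanSpace ℝ (Fin n)) 1)
    (x : sphere (0 : EuclideanSpace ℝ (Fin n)) 1) {t : ℝ} (ht : 0 < t) :
    radialExt φ (t • (x : EuclideanSpace ℝ (Fin n))) = t • (φ x : EuclideanSpace ℝ (Fin n)) := by
  have hnorm : ‖t • (x : EuclideanSpace ℝ (Fin n))‖ = t := by
    rw [norm_smul, norm_eq_of_mem_sphere, mul_one, Real.norm_of_nonneg ht.le]
  have hv : t • (x : EuclideanSpace ℝ (Fin n)) ≠ 0 := by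
    rw [← norm_ne_zero_iff, hnorm]
    exact ht.ne'
  rw [radialExt, dif_neg hv]
  simp only [hnorm, inv_smul_smul₀ ht.ne', Subtype.coe_eta]

theorem radialExt_unbounded_distance {n : ℕ} (hn : 1 ≤ n)
    (φ ψ : sphere (0 : EuclideanSpace ℝ (Fin n)) 1 → sphere (0 : EuclideanSpace ℝ (Fin n)) 1)
    (hne : φ ≠ ψ) :
    ∀ N : ℝ, 0 < N → ∃ v : EuclideanSpace ℝ (Fin n), ‖radialExt φ v - radialExt ψ v‖ > N := by
  intro N hN
  obtain ⟨x, hx⟩ := Function.ne_iff.mp hne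
  have hd : 0 < ‖(φ x : EuclideanSpace ℝ (Fin n)) - ψ x‖ :=
    norm_pos_iff.mpr (sub_ne_zero.mpr (Subtype.coe_injective.ne hx))
  obtain ⟨t, ht⟩ := exists_gt (N / ‖(φ x : EuclideanSpace ℝ (Fin n)) - ψ x‖)
  have ht0 : 0 < t := (div_pos hN hd).trans ht
  refine ⟨t • (x : EuclideanSpace ℝ (Fin n)), ?_⟩
  rw [radialExt_smul_of_pos φ x ht0, radialExt_smul_of_pos ψ x ht0, ← smul_sub, norm_smul,
    Real.norm_of_nonneg ht0.le]
  exact (div_lt_iff₀ hd).mp ht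
end

section
/- Let n ≥ 1 and λ ≥ 1. Let g : ℝ^n → ℝ^n satisfy g(v) = v whenever ‖v‖ ≥ 1, and suppose g is λ-bi-Lipschitz: λ⁻¹‖x−y‖ ≤ ‖g(x)−g(y)‖ ≤ λ‖x−y‖ for all x,y ∈ ℝ^n. Then Ψ(g) is λ-bi-Lipschitz: λ⁻¹‖x−y‖ ≤ ‖Ψ(g)(x)−Ψ(g)(y)‖ ≤ λ‖x−y‖ for all x,y ∈ ℝ^n. -/
open Metric

section SupportedInBall

variable {E : Type*} [NormedAddCommGroup E]

/-- An injective map fixing the complement of an open ball maps the closed ball into itself. -/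
theorem norm_map_sub_le_of_fixes_outside {F : E → E} {c : E} {r : ℝ} (hinj : Function.Injective F)
    (hid : ∀ v, r ≤ ‖v - c‖ → F v = v) {v : E} (hv : ‖v - c‖ ≤ r) : ‖F v - c‖ ≤ r := by
  by_contra! h
  have h1 : F v = v := hinj (hid _ h.le)
  rw [h1] at h
  linarith

theorem injective_of_inv_mul_norm_sub_le {F : E → E} {lam : ℝ} (hlam : 0 < lam)
    (hF : ∀ x y, lam⁻¹ * ‖x - y‖ ≤ ‖F x - F y‖) : Function.Injective F := by
  intro x y hxy
  have h := hF x y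
  rw [hxy, sub_self, norm_zero] at h
  have h' : ‖x - y‖ ≤ 0 := nonpos_of_mul_nonpos_right h (inv_pos.2 hlam)
  exact sub_eq_zero.1 (norm_le_zero_iff.1 h')

variable [NormedSpace ℝ E]

/-- A segment from a point of a closed ball to a point outside the open ball meets the sphere. -/
theorem exists_norm_sub_eq_and_norm_add_norm_eq {c x y : E} {r : ℝ} (hx : ‖x - c‖ ≤ r)
    (hy : r ≤ ‖y - c‖) : ∃ p, ‖p - c‖ = r ∧ ‖x - p‖ + ‖p - y‖ = ‖x - y‖ := by
  have hcont : ContinuousOn (fun p : E => ‖p - c‖) (segment ℝ x y) := by fun_prop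
  obtain ⟨p, hp, hpr⟩ := (convex_segment x y).isPreconnected.intermediate_value
    (left_mem_segment ℝ x y) (right_mem_segment ℝ x y) hcont ⟨hx, hy⟩
  refine ⟨p, hpr, ?_⟩
  simpa only [dist_eq_norm] using dist_add_dist_of_mem_segment hp

/-- Two bi-Lipschitz maps supported in balls with disjoint interiors satisfy the joint bi-Lipschitz
bounds between points of the two balls. -/
theorem biLipschitz_of_mem_balls {F G : E → E} {lam r s : ℝ} {c d : E}
    (hF : Function.Injective F) (hG : Function.Injective G)
    (hFid : ∀ v, r ≤ ‖v - c‖ → F v = v) (hGid : ∀ v, s ≤ ‖v - d‖ → G v = v)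
    (hlam : 0 ≤ lam)
    (hFb : ∀ x y, lam⁻¹ * ‖x - y‖ ≤ ‖F x - F y‖ ∧ ‖F x - F y‖ ≤ lam * ‖x - y‖)
    (hGb : ∀ x y, lam⁻¹ * ‖x - y‖ ≤ ‖G x - G y‖ ∧ ‖G x - G y‖ ≤ lam * ‖x - y‖)
    (hcd : r + s ≤ ‖c - d‖) {x y : E} (hx : ‖x - c‖ ≤ r) (hy : ‖y - d‖ ≤ s) :
    lam⁻¹ * ‖x - y‖ ≤ ‖F x - G y‖ ∧ ‖F x - G y‖ ≤ lam * ‖x - y‖ := by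
  have far : ∀ w, r + s ≤ ‖w - c‖ + ‖w - d‖ := fun w => by
    have := norm_sub_le_norm_sub_add_norm_sub c w d
    rw [norm_sub_rev c w] at this
    linarith
  constructor
  · have hFx := norm_map_sub_le_of_fixes_outside hF hFid hx
    have hGy := norm_map_sub_le_of_fixes_outside hG hGid hy
    obtain ⟨p, hp, hsum⟩ := exists_norm_sub_eq_and_norm_add_norm_eq hFx
      (show r ≤ ‖G y - c‖ by linarith [far (G y)])
    have h1 := (hFb x p).1
    have h2 := (hGb p y).1
    rw [hFid p hp.ge] at h1
    rw [hGid p (by linarith [far p])] at h2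
    calc lam⁻¹ * ‖x - y‖ ≤ lam⁻¹ * (‖x - p‖ + ‖p - y‖) := by
          gcongr
          exact norm_sub_le_norm_sub_add_norm_sub x p y
      _ ≤ ‖F x - G y‖ := by linarith
  · obtain ⟨p, hp, hsum⟩ := exists_norm_sub_eq_and_norm_add_norm_eq hx
      (show r ≤ ‖y - c‖ by linarith [far y])
    have h1 := (hFb x p).2
    have h2 := (hGb p y).2
    rw [hFid p hp.ge] at h1
    rw [hGid p (by linarith [far p])] at h2
    have h3 := norm_sub_le_norm_sub_add_norm_sub (F x) p (G y)
    rw [← hsum, mul_add]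
    linarith

/-- The conjugate of `g` by the homothety taking the unit ball to the ball of center `c` and
radius `r`. -/
noncomputable def rescale (g : E → E) (c : E) (r : ℝ) (v : E) : E := c + r • g (r⁻¹ • (v - c))

theorem rescale_eq_self {g : E → E} (hg : ∀ v, 1 ≤ ‖v‖ → g v = v) {c : E} {r : ℝ} (hr : 0 < r)
    {v : E} (hv : r ≤ ‖v - c‖) : rescale g c r v = v := by
  have h : 1 ≤ ‖r⁻¹ • (v - c)‖ := by
    rw [norm_smul, norm_inv, Real.norm_of_nonneg hr.le, ← div_eq_inv_mul, one_le_div hr]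
    exact hv
  rw [rescale, hg _ h, smul_inv_smul₀ hr.ne', add_sub_cancel]

theorem rescale_biLipschitz {g : E → E} {lam : ℝ}
    (hg : ∀ x y, lam⁻¹ * ‖x - y‖ ≤ ‖g x - g y‖ ∧ ‖g x - g y‖ ≤ lam * ‖x - y‖)
    (c : E) {r : ℝ} (hr : 0 < r) (x y : E) :
    lam⁻¹ * ‖x - y‖ ≤ ‖rescale g c r x - rescale g c r y‖ ∧
      ‖rescale g c r x - rescale g c r y‖ ≤ lam * ‖x - y‖ := by
  have h1 : ‖rescale g c r x - rescale g c r y‖ =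
      r * ‖g (r⁻¹ • (x - c)) - g (r⁻¹ • (y - c))‖ := by
    rw [rescale, rescale, add_sub_add_left_eq_sub, ← smul_sub, norm_smul,
      Real.norm_of_nonneg hr.le]
  have h2 : ‖x - y‖ = r * ‖r⁻¹ • (x - c) - r⁻¹ • (y - c)‖ := by
    rw [← smul_sub, sub_sub_sub_cancel_right, norm_smul, norm_inv, Real.norm_of_nonneg hr.le,
      mul_inv_cancel_left₀ hr.ne']
  obtain ⟨hl, hu⟩ := hg (r⁻¹ • (x - c)) (r⁻¹ • (y - c))
  rw [h1, h2, mul_left_comm, mul_left_comm lam]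
  exact ⟨by gcongr, by gcongr⟩

/-- A map agreeing with bi-Lipschitz maps supported in balls with pairwise disjoint interiors, and
equal to the identity elsewhere, is bi-Lipschitz with the same constant. -/
theorem biLipschitz_of_supported_in_balls {ι : Type*} {lam : ℝ} (hlam : 1 ≤ lam)
    {c : ι → E} {r : ι → ℝ} {F : ι → E → E} {Φ : E → E}
    (hFid : ∀ i v, r i ≤ ‖v - c i‖ → F i v = v)
    (hFb : ∀ i x y, lam⁻¹ * ‖x - y‖ ≤ ‖F i x - F i y‖ ∧ ‖F i x - F i y‖ ≤ lam * ‖x - y‖)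
    (hsep : ∀ i j, i ≠ j → r i + r j ≤ ‖c i - c j‖)
    (hin : ∀ i v, ‖v - c i‖ ≤ r i → Φ v = F i v)
    (hout : ∀ v, (∀ i, r i < ‖v - c i‖) → Φ v = v) (x y : E) :
    lam⁻¹ * ‖x - y‖ ≤ ‖Φ x - Φ y‖ ∧ ‖Φ x - Φ y‖ ≤ lam * ‖x - y‖ := by
  have hpos : 0 < lam := by linarith
  have hinj : ∀ i, Function.Injective (F i) := fun i =>
    injective_of_inv_mul_norm_sub_le hpos fun x y => (hFb i x y).1
  by_cases hx : ∃ i, ‖x - c i‖ ≤ r i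
  · obtain ⟨i, hi⟩ := hx
    rw [hin i x hi]
    by_cases hy : ∃ j, ‖y - c j‖ ≤ r j
    · obtain ⟨j, hj⟩ := hy
      rw [hin j y hj]
      rcases eq_or_ne i j with rfl | hij
      · exact hFb i x y
      · exact biLipschitz_of_mem_balls (hinj i) (hinj j) (hFid i) (hFid j) hpos.le (hFb i) (hFb j)
          (hsep i j hij) hi hj
    · push Not at hy
      rw [hout y hy, ← hFid i y (hy i).le]
      simpa only [hFid i y (hy i).le] using hFb i x y
  · push Not at hx
    rw [hout x hx]
    by_cases hy : ∃ j, ‖y - c j‖ ≤ r j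
    · obtain ⟨j, hj⟩ := hy
      rw [hin j y hj]
      simpa only [hFid j x (hx j).le] using hFb j x y
    · push Not at hy
      rw [hout y hy]
      exact ⟨mul_le_of_le_one_left (norm_nonneg _) (inv_le_one_of_one_le₀ hlam),
        le_mul_of_one_le_left (norm_nonneg _) hlam⟩

end SupportedInBall

theorem two_pow_add_two_pow_le {i j : ℕ} (hij : i < j) :
    (2 : ℝ) ^ i + 2 ^ j ≤ 4 ^ j - 4 ^ i := by
  have h4 : ∀ k : ℕ, (4 : ℝ) ^ k = 2 ^ k * 2 ^ k := fun k => by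
    rw [← mul_pow]
    norm_num
  have h1 : (1 : ℝ) ≤ 2 ^ i := one_le_pow₀ (by norm_num)
  have h2 : (2 : ℝ) ^ (i + 1) ≤ 2 ^ j := pow_le_pow_right₀ (by norm_num) hij
  rw [pow_succ] at h2
  rw [h4, h4]
  nlinarith

theorem two_pow_add_two_pow_le_norm_sub {E : Type*} [NormedAddCommGroup E] [NormedSpace ℝ E]
    {e : E} (he : ‖e‖ = 1) {c : ℕ → E} (hc0 : c 0 = 0)
    (hc : ∀ j, 1 ≤ j → c j = (4 ^ j : ℝ) • e) {i j : ℕ} (hij : i < j) :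
    (2 : ℝ) ^ i + 2 ^ j ≤ ‖c i - c j‖ := by
  have h := two_pow_add_two_pow_le hij
  rw [norm_sub_rev, hc j (by lia)]
  rcases Nat.eq_zero_or_pos i with rfl | hi
  · rw [hc0, sub_zero, norm_smul, he, mul_one, Real.norm_of_nonneg (by positivity)]
    rw [pow_zero (4 : ℝ)] at h
    linarith
  · rw [hc i hi, ← sub_smul, norm_smul, he, mul_one]
    exact h.trans (le_abs_self _)

theorem psi_biLipschitz {n : ℕ} (hn : 1 ≤ n) (lam : ℝ) (hlam : 1 ≤ lam)
    (g : EuclideanSpace ℝ (Fin n) → EuclideanSpace ℝ (Fin n))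
    (hg_id : ∀ v : EuclideanSpace ℝ (Fin n), 1 ≤ ‖v‖ → g v = v)
    (hg_low : ∀ x y : EuclideanSpace ℝ (Fin n), lam⁻¹ * ‖x - y‖ ≤ ‖g x - g y‖)
    (hg_up : ∀ x y : EuclideanSpace ℝ (Fin n), ‖g x - g y‖ ≤ lam * ‖x - y‖)
    -- `e₁` is the first standard basis vector
    (e₁ : EuclideanSpace ℝ (Fin n)) (he₁ : e₁ = EuclideanSpace.single (⟨0, hn⟩ : Fin n) 1)
    -- `C j` is the closed ball `C_j`
    (C : ℕ → Set (EuclideanSpace ℝ (Fin n)))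
    (hC0 : C 0 = closedBall (0 : EuclideanSpace ℝ (Fin n)) 1)
    (hCj : ∀ j : ℕ, 1 ≤ j → C j = closedBall ((4 ^ j : ℝ) • e₁) (2 ^ j))
    -- `Ψg` is the map `Ψ(g)`
    (Ψg : EuclideanSpace ℝ (Fin n) → EuclideanSpace ℝ (Fin n))
    (hΨ0 : ∀ v ∈ C 0, Ψg v = g v)
    (hΨj : ∀ j : ℕ, 1 ≤ j → ∀ v ∈ C j,
      Ψg v = (4 ^ j : ℝ) • e₁ + (2 ^ j : ℝ) • g ((2 ^ j : ℝ)⁻¹ • (v - (4 ^ j : ℝ) • e₁)))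
    (hΨout : ∀ v : EuclideanSpace ℝ (Fin n), (∀ j : ℕ, v ∉ C j) → Ψg v = v) :
    ∀ x y : EuclideanSpace ℝ (Fin n),
      lam⁻¹ * ‖x - y‖ ≤ ‖Ψg x - Ψg y‖ ∧ ‖Ψg x - Ψg y‖ ≤ lam * ‖x - y‖ := by
  set c : ℕ → EuclideanSpace ℝ (Fin n) := fun j => if j = 0 then 0 else (4 ^ j : ℝ) • e₁ with hc
  have hc0 : c 0 = 0 := by simp [hc]
  have hcj : ∀ j, 1 ≤ j → c j = (4 ^ j : ℝ) • e₁ := fun j hj => by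
    simp [hc, Nat.one_le_iff_ne_zero.1 hj]
  have he : ‖e₁‖ = 1 := by simp [he₁]
  have hmem : ∀ j v, v ∈ C j ↔ ‖v - c j‖ ≤ 2 ^ j := by
    intro j v
    rcases Nat.eq_zero_or_pos j with rfl | hj
    · rw [hC0, hc0, mem_closedBall_iff_norm, pow_zero]
    · rw [hCj j hj, hcj j hj, mem_closedBall_iff_norm]
  refine biLipschitz_of_supported_in_balls (c := c) (r := fun j => 2 ^ j)
    (F := fun j => rescale g (c j) (2 ^ j)) hlam
    (fun j v hv => rescale_eq_self hg_id (by positivity) hv)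
    (fun j => rescale_biLipschitz (fun x y => ⟨hg_low x y, hg_up x y⟩) (c j) (by positivity))
    ?_ ?_ ?_
  · intro i j hij
    rcases hij.lt_or_gt with h | h
    · exact two_pow_add_two_pow_le_norm_sub he hc0 hcj h
    · rw [add_comm, norm_sub_rev]
      exact two_pow_add_two_pow_le_norm_sub he hc0 hcj h
  · intro j v hv
    have hvC := (hmem j v).2 hv
    rcases Nat.eq_zero_or_pos j with rfl | hj
    · simp [hΨ0 v hvC, rescale, hc0]
    · rw [hΨj j hj v hvC, rescale, hcj j hj]
  · intro v hv
    exact hΨout v fun j hj => (hv j).not_ge ((hmem j v).1 hj)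
end

section
/- Let n ≥ 1 and let g : ℝ^n → ℝ^n satisfy g(v) = v whenever ‖v‖ ≥ 1, with g not equal to the identity map. Then Ψ(g) is at unbounded distance from the identity: for every N > 0 there exists v ∈ ℝ^n with ‖Ψ(g)(v) − v‖ > N. -/
open Metric

theorem psi_unbounded_from_id {n : ℕ} (hn : 1 ≤ n)
    (g : EuclideanSpace ℝ (Fin n) → EuclideanSpace ℝ (Fin n))
    (hg_id : ∀ v : EuclideanSpace ℝ (Fin n), 1 ≤ ‖v‖ → g v = v)
    (hg_ne : g ≠ id)
    -- `e₁` is the first standard basis vector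
    (e₁ : EuclideanSpace ℝ (Fin n)) (he₁ : e₁ = EuclideanSpace.single (⟨0, hn⟩ : Fin n) 1)
    -- `C j` is the closed ball `C_j`
    (C : ℕ → Set (EuclideanSpace ℝ (Fin n)))
    (hC0 : C 0 = closedBall (0 : EuclideanSpace ℝ (Fin n)) 1)
    (hCj : ∀ j : ℕ, 1 ≤ j → C j = closedBall ((4 ^ j : ℝ) • e₁) (2 ^ j))
    -- `Ψg` is the map `Ψ(g)`
    (Ψg : EuclideanSpace ℝ (Fin n) → EuclideanSpace ℝ (Fin n))
    (hΨ0 : ∀ v ∈ C 0, Ψg v = g v)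
    (hΨj : ∀ j : ℕ, 1 ≤ j → ∀ v ∈ C j,
      Ψg v = (4 ^ j : ℝ) • e₁ + (2 ^ j : ℝ) • g ((2 ^ j : ℝ)⁻¹ • (v - (4 ^ j : ℝ) • e₁)))
    (hΨout : ∀ v : EuclideanSpace ℝ (Fin n), (∀ j : ℕ, v ∉ C j) → Ψg v = v) :
    ∀ N : ℝ, 0 < N → ∃ v : EuclideanSpace ℝ (Fin n), ‖Ψg v - v‖ > N := by
  intro N _
  obtain ⟨v, hv⟩ := Function.ne_iff.mp hg_ne
  have hv1 : ‖v‖ < 1 := lt_of_not_ge fun h => hv (hg_id v h)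
  have hpos : 0 < ‖g v - v‖ := norm_pos_iff.mpr (sub_ne_zero.mpr hv)
  obtain ⟨k, hk⟩ := pow_unbounded_of_one_lt (N / ‖g v - v‖) (one_lt_two : (1 : ℝ) < 2)
  have hk' : N / ‖g v - v‖ < 2 ^ (k + 1) :=
    hk.trans_le (pow_le_pow_right₀ one_le_two k.le_succ)
  have h2 : (0 : ℝ) < 2 ^ (k + 1) := by positivity
  have hmem : (4 ^ (k + 1) : ℝ) • e₁ + (2 ^ (k + 1) : ℝ) • v ∈ C (k + 1) := by
    rw [hCj _ k.succ_pos, mem_closedBall_iff_norm, add_sub_cancel_left, norm_smul,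
      Real.norm_of_nonneg h2.le]
    exact mul_le_of_le_one_right h2.le hv1.le
  refine ⟨(4 ^ (k + 1) : ℝ) • e₁ + (2 ^ (k + 1) : ℝ) • v, ?_⟩
  rw [hΨj _ k.succ_pos _ hmem, add_sub_cancel_left, inv_smul_smul₀ h2.ne',
    add_sub_add_left_eq_sub, ← smul_sub, norm_smul, Real.norm_of_nonneg h2.le]
  exact (div_lt_iff₀ hpos).mp hk'
end

section
/- Let n ≥ 1 and λ ≥ 1. For each j ∈ ℕ let g_j : ℝ^n → ℝ^n satisfy g_j(v) = v whenever v ∉ closedBall(2j • e₁, 1), and suppose each g_j is λ-bi-Lipschitz: λ⁻¹‖x−y‖ ≤ ‖g_j(x)−g_j(y)‖ ≤ λ‖x−y‖ for all x,y. Define h : ℝ^n → ℝ^n by h(v) = g_j(v) if v ∈ closedBall(2j • e₁, 1) for some j ∈ ℕ (these balls are pairwise disjoint, so h is well defined), and h(v) = v otherwise. Then h is λ-bi-Lipschitz. -/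
open Metric

section Glue

variable {E : Type*} [NormedAddCommGroup E] [NormedSpace ℝ E]

/-- A segment from a point of a closed ball to a point outside the open ball meets the sphere. -/
theorem exists_mem_segment_dist_eq {c x y : E} {r : ℝ} (hx : dist x c ≤ r) (hy : r ≤ dist y c) :
    ∃ p ∈ segment ℝ x y, dist p c = r := by
  have hcont : ContinuousOn (fun p => dist p c) (segment ℝ x y) := by fun_prop
  obtain ⟨p, hp, hpr⟩ := (convex_segment (𝕜 := ℝ) x y).isPreconnected.intermediate_value
    (left_mem_segment ℝ x y) (right_mem_segment ℝ x y) hcont ⟨hx, hy⟩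
  exact ⟨p, hp, hpr⟩

/-- A continuous map which is the identity off a closed ball is the identity off the open ball. -/
theorem eq_self_of_le_dist {f : E → E} (hf : Continuous f) {c : E} {r : ℝ} (hr : r ≠ 0)
    (hid : ∀ v, v ∉ closedBall c r → f v = v) {v : E} (hv : r ≤ dist v c) : f v = v := by
  have hsub : closure (closedBall c r)ᶜ ⊆ {v | f v = v} :=
    closure_minimal hid (isClosed_eq hf continuous_id)
  apply hsub
  rw [closure_compl, interior_closedBall c hr]
  simpa using hv

/-- An injective map which is the identity off a set maps this set to itself. -/
theorem mapsTo_of_injective_of_eq_self {α : Type*} {f : α → α} (hf : Function.Injective f)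
    {s : Set α} (hid : ∀ v, v ∉ s → f v = v) : Set.MapsTo f s s := by
  intro v hv
  by_contra hfv
  rw [hf (hid _ hfv)] at hfv
  exact hfv hv

/-- Distance estimate across two closed balls with disjoint interiors, when the displacements
`x ↦ u` and `y ↦ v` are controlled relative to the points outside the open balls. -/
theorem norm_sub_le_of_separated_balls {lam r : ℝ} {c d x y u v : E} (hcd : 2 * r ≤ dist c d)
    (hx : dist x c ≤ r) (hy : dist y d ≤ r)
    (hu : ∀ p, r ≤ dist p c → ‖u - p‖ ≤ lam * ‖x - p‖)
    (hv : ∀ p, r ≤ dist p d → ‖p - v‖ ≤ lam * ‖p - y‖) :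
    ‖u - v‖ ≤ lam * ‖x - y‖ := by
  have hyc : r ≤ dist y c := by
    linarith [dist_triangle c y d, dist_comm c y]
  obtain ⟨p, hp, hpc⟩ := exists_mem_segment_dist_eq hx hyc
  have hpd : r ≤ dist p d := by
    linarith [dist_triangle c p d, dist_comm c p]
  have hsum := dist_add_dist_of_mem_segment hp
  simp only [dist_eq_norm] at hsum
  calc ‖u - v‖ ≤ ‖u - p‖ + ‖p - v‖ := norm_sub_le_norm_sub_add_norm_sub u p v
    _ ≤ lam * ‖x - p‖ + lam * ‖p - y‖ := add_le_add (hu p hpc.ge) (hv p hpd)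
    _ = lam * ‖x - y‖ := by rw [← mul_add, hsum]

end Glue

theorem uniform_biLipschitz_glue {n : ℕ} (hn : 1 ≤ n) (lam : ℝ) (hlam : 1 ≤ lam)
    -- `e₁` is the first standard basis vector
    (e₁ : EuclideanSpace ℝ (Fin n)) (he₁ : e₁ = EuclideanSpace.single (⟨0, hn⟩ : Fin n) 1)
    (g : ℕ → EuclideanSpace ℝ (Fin n) → EuclideanSpace ℝ (Fin n))
    (hg_id : ∀ (j : ℕ) (v : EuclideanSpace ℝ (Fin n)),
      v ∉ closedBall ((2 * j : ℝ) • e₁) 1 → g j v = v)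
    (hg_low : ∀ (j : ℕ) (x y : EuclideanSpace ℝ (Fin n)),
      lam⁻¹ * ‖x - y‖ ≤ ‖g j x - g j y‖)
    (hg_up : ∀ (j : ℕ) (x y : EuclideanSpace ℝ (Fin n)),
      ‖g j x - g j y‖ ≤ lam * ‖x - y‖)
    (h : EuclideanSpace ℝ (Fin n) → EuclideanSpace ℝ (Fin n))
    (hh_in : ∀ (j : ℕ) (v : EuclideanSpace ℝ (Fin n)),
      v ∈ closedBall ((2 * j : ℝ) • e₁) 1 → h v = g j v)
    (hh_out : ∀ v : EuclideanSpace ℝ (Fin n),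
      (∀ j : ℕ, v ∉ closedBall ((2 * j : ℝ) • e₁) 1) → h v = v) :
    ∀ x y : EuclideanSpace ℝ (Fin n),
      lam⁻¹ * ‖x - y‖ ≤ ‖h x - h y‖ ∧ ‖h x - h y‖ ≤ lam * ‖x - y‖ := by
  have hlam0 : 0 < lam := by linarith
  have hup_inv (j : ℕ) (x y : EuclideanSpace ℝ (Fin n)) :
      ‖x - y‖ ≤ lam * ‖g j x - g j y‖ := by
    simpa [inv_mul_le_iff₀ hlam0] using hg_low j x y
  have hcont (j : ℕ) : Continuous (g j) :=
    (LipschitzWith.of_dist_le_mul (K := ⟨lam, hlam0.le⟩) fun x y => by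
      rw [dist_eq_norm, dist_eq_norm]
      exact hg_up j x y).continuous
  have hinj (j : ℕ) : Function.Injective (g j) := fun x y hxy => by
    simpa [hxy, sub_eq_zero] using hup_inv j x y
  have hfix (j : ℕ) {v : EuclideanSpace ℝ (Fin n)}
      (hv : 1 ≤ dist v ((2 * j : ℝ) • e₁)) : g j v = v :=
    eq_self_of_le_dist (hcont j) one_ne_zero (hg_id j) hv
  have hmaps (j : ℕ) := mapsTo_of_injective_of_eq_self (hinj j) (hg_id j)
  have hsep {i j : ℕ} (hij : i ≠ j) :
      2 * (1 : ℝ) ≤ dist ((2 * i : ℝ) • e₁) ((2 * j : ℝ) • e₁) := by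
    have he : ‖e₁‖ = 1 := by simp [he₁]
    have hone : (1 : ℝ) ≤ |(i : ℝ) - j| := by
      exact_mod_cast Int.one_le_abs (sub_ne_zero.2 (Nat.cast_injective.ne hij : (i : ℤ) ≠ j))
    rw [dist_eq_norm, ← sub_smul, norm_smul, he, ← mul_sub, Real.norm_eq_abs, abs_mul, abs_two]
    linarith
  have of_eq (j : ℕ) {x y : EuclideanSpace ℝ (Fin n)} (hx : h x = g j x) (hy : h y = g j y) :
      lam⁻¹ * ‖x - y‖ ≤ ‖h x - h y‖ ∧ ‖h x - h y‖ ≤ lam * ‖x - y‖ := by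
    rw [hx, hy]
    exact ⟨hg_low j x y, hg_up j x y⟩
  intro x y
  by_cases hx : ∃ i : ℕ, x ∈ closedBall ((2 * i : ℝ) • e₁) 1
  · obtain ⟨i, hi⟩ := hx
    by_cases hy : ∃ j : ℕ, y ∈ closedBall ((2 * j : ℝ) • e₁) 1
    · obtain ⟨j, hj⟩ := hy
      obtain rfl | hij := eq_or_ne i j
      · exact of_eq i (hh_in i x hi) (hh_in i y hj)
      rw [hh_in i x hi, hh_in j y hj, inv_mul_le_iff₀ hlam0]
      constructor
      · refine norm_sub_le_of_separated_balls (hsep hij) (hmaps i hi) (hmaps j hj)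
          (fun p hp => ?_) (fun p hp => ?_)
        · simpa only [hfix i hp] using hup_inv i x p
        · simpa only [hfix j hp] using hup_inv j p y
      · refine norm_sub_le_of_separated_balls (hsep hij) hi hj
          (fun p hp => ?_) (fun p hp => ?_)
        · simpa only [hfix i hp] using hg_up i x p
        · simpa only [hfix j hp] using hg_up j p y
    · push Not at hy
      exact of_eq i (hh_in i x hi) ((hh_out y hy).trans (hg_id i y (hy i)).symm)
  · push Not at hx
    have hxg (j : ℕ) : h x = g j x := (hh_out x hx).trans (hg_id j x (hx j)).symm
    by_cases hy : ∃ j : ℕ, y ∈ closedBall ((2 * j : ℝ) • e₁) 1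
    · obtain ⟨j, hj⟩ := hy
      exact of_eq j (hxg j) (hh_in j y hj)
    · push Not at hy
      exact of_eq 0 (hxg 0) ((hh_out y hy).trans (hg_id 0 y (hy 0)).symm)
end

section
/- Let n ≥ 1 and C ≥ 0. Let f : ℝ → Matrix (Fin n) (Fin n) ℝ be such that f(t) ∈ SO(n) for every t > 0, and such that for all indices i, j the entry function t ↦ f(t) i j is differentiable at every t > 0 with |derivative at t| ≤ C/t. Then the spiral map φ_f is (nC+1)-bi-Lipschitz: (nC+1)⁻¹‖x−y‖ ≤ ‖φ_f(x) − φ_f(y)‖ ≤ (nC+1)‖x−y‖ for all x, y ∈ ℝ^n. -/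
open Matrix

/-- The spiral map `φ_f(x) = f(‖x‖) x` associated with a one-parameter family of matrices. -/
noncomputable def spiral {n : ℕ} (f : ℝ → Matrix (Fin n) (Fin n) ℝ)
    (x : EuclideanSpace ℝ (Fin n)) : EuclideanSpace ℝ (Fin n) :=
  (EuclideanSpace.equiv (Fin n) ℝ).symm ((f ‖x‖).mulVec (EuclideanSpace.equiv (Fin n) ℝ x))

theorem norm_toLp_mulVec_of_transpose_mul_self {n : ℕ} {A : Matrix (Fin n) (Fin n) ℝ}
    (hA : Aᵀ * A = 1) (v : Fin n → ℝ) :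
    ‖WithLp.toLp 2 (A *ᵥ v)‖ = ‖WithLp.toLp 2 v‖ := by
  have h : (A *ᵥ v) ⬝ᵥ (A *ᵥ v) = v ⬝ᵥ v := by
    rw [dotProduct_mulVec, ← mulVec_transpose, mulVec_mulVec, hA, one_mulVec]
  rw [EuclideanSpace.norm_eq, EuclideanSpace.norm_eq]
  congr 1
  simpa [dotProduct, sq] using h

theorem norm_toLp_mulVec_le_of_abs_le {n : ℕ} {A : Matrix (Fin n) (Fin n) ℝ} {c : ℝ}
    (hc : 0 ≤ c) (hA : ∀ i j, |A i j| ≤ c) (v : Fin n → ℝ) :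
    ‖WithLp.toLp 2 (A *ᵥ v)‖ ≤ n * c * ‖WithLp.toLp 2 v‖ := by
  refine abs_le_of_sq_le_sq' ?_ (by positivity) |>.2
  rw [mul_pow, EuclideanSpace.real_norm_sq_eq, EuclideanSpace.real_norm_sq_eq]
  have h (i : Fin n) : (A *ᵥ v) i ^ 2 ≤ n * c ^ 2 * ∑ j, v j ^ 2 := by
    refine (Finset.sum_mul_sq_le_sq_mul_sq Finset.univ (A i) v).trans ?_
    gcongr
    calc ∑ j, A i j ^ 2 ≤ ∑ _j : Fin n, c ^ 2 :=
          Finset.sum_le_sum fun j _ => sq_le_sq' (abs_le.1 (hA i j)).1 (abs_le.1 (hA i j)).2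
      _ = n * c ^ 2 := by simp
  calc ∑ i, (A *ᵥ v) i ^ 2 ≤ ∑ _i : Fin n, n * c ^ 2 * ∑ j, v j ^ 2 :=
        Finset.sum_le_sum fun i _ => h i
    _ = (n * c) ^ 2 * ∑ j, v j ^ 2 := by simp; ring

theorem abs_sub_le_of_abs_deriv_le_div {g : ℝ → ℝ} {C : ℝ} (hC : 0 ≤ C)
    (hg : ∀ t, 0 < t → DifferentiableAt ℝ g t ∧ |deriv g t| ≤ C / t)
    {s r : ℝ} (hs : 0 < s) (hsr : s ≤ r) : |g r - g s| ≤ C / s * (r - s) := by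
  have h := (convex_Icc s r).norm_image_sub_le_of_norm_deriv_le (f := g) (C := C / s)
    (fun t ht => (hg t (hs.trans_le ht.1)).1)
    (fun t ht => (hg t (hs.trans_le ht.1)).2.trans
      (div_le_div_of_nonneg_left hC hs ht.1))
    (Set.left_mem_Icc.2 hsr) (Set.right_mem_Icc.2 hsr)
  rwa [Real.norm_eq_abs, Real.norm_eq_abs, abs_of_nonneg (sub_nonneg.2 hsr)] at h

theorem spiral_eq_toLp {n : ℕ} (f : ℝ → Matrix (Fin n) (Fin n) ℝ)
    (x : EuclideanSpace ℝ (Fin n)) : spiral f x = WithLp.toLp 2 (f ‖x‖ *ᵥ x.ofLp) := rfl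

theorem spiral_zero {n : ℕ} (f : ℝ → Matrix (Fin n) (Fin n) ℝ) : spiral f 0 = 0 := by
  simp [spiral]

theorem norm_spiral {n : ℕ} {f : ℝ → Matrix (Fin n) (Fin n) ℝ}
    (hf : ∀ t, 0 < t → (f t)ᵀ * f t = 1) (x : EuclideanSpace ℝ (Fin n)) :
    ‖spiral f x‖ = ‖x‖ := by
  rcases eq_or_ne x 0 with rfl | hx
  · rw [spiral_zero]
  · exact norm_toLp_mulVec_of_transpose_mul_self (hf _ (norm_pos_iff.2 hx)) x.ofLp

theorem spiral_transpose_spiral {n : ℕ} {f : ℝ → Matrix (Fin n) (Fin n) ℝ}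
    (hf : ∀ t, 0 < t → (f t)ᵀ * f t = 1) (x : EuclideanSpace ℝ (Fin n)) :
    spiral (fun t => (f t)ᵀ) (spiral f x) = x := by
  rcases eq_or_ne x 0 with rfl | hx
  · rw [spiral_zero, spiral_zero]
  · rw [spiral_eq_toLp _ (spiral f x), norm_spiral hf, spiral_eq_toLp, mulVec_mulVec,
      hf _ (norm_pos_iff.2 hx), one_mulVec]

theorem norm_spiral_sub_spiral_le {n : ℕ} {C : ℝ} (hC : 0 ≤ C)
    {f : ℝ → Matrix (Fin n) (Fin n) ℝ} (hf : ∀ t, 0 < t → (f t)ᵀ * f t = 1)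
    (hderiv : ∀ (i j : Fin n) (t : ℝ), 0 < t →
      DifferentiableAt ℝ (fun s => f s i j) t ∧ |deriv (fun s => f s i j) t| ≤ C / t)
    (x y : EuclideanSpace ℝ (Fin n)) :
    ‖spiral f x - spiral f y‖ ≤ (n * C + 1) * ‖x - y‖ := by
  wlog hyx : ‖y‖ ≤ ‖x‖ generalizing x y
  · rw [norm_sub_rev, norm_sub_rev x]
    exact this y x (le_of_not_ge hyx)
  rcases eq_or_ne y 0 with rfl | hy
  · rw [spiral_zero, sub_zero, sub_zero, norm_spiral hf]
    exact le_mul_of_one_le_left (norm_nonneg x) (le_add_of_nonneg_left (by positivity))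
  have hy' : 0 < ‖y‖ := norm_pos_iff.2 hy
  have hsplit : spiral f x - spiral f y = WithLp.toLp 2 (f ‖x‖ *ᵥ (x - y).ofLp) +
      WithLp.toLp 2 ((f ‖x‖ - f ‖y‖) *ᵥ y.ofLp) := by
    rw [spiral_eq_toLp, spiral_eq_toLp, WithLp.ofLp_sub, mulVec_sub, sub_mulVec,
      ← WithLp.toLp_sub, ← WithLp.toLp_add]
    congr 1
    abel
  have hrot : ‖WithLp.toLp 2 (f ‖x‖ *ᵥ (x - y).ofLp)‖ = ‖x - y‖ :=
    norm_toLp_mulVec_of_transpose_mul_self (hf _ (hy'.trans_le hyx)) _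
  have hdiff : ‖WithLp.toLp 2 ((f ‖x‖ - f ‖y‖) *ᵥ y.ofLp)‖ ≤
      n * (C / ‖y‖ * (‖x‖ - ‖y‖)) * ‖y‖ :=
    norm_toLp_mulVec_le_of_abs_le (mul_nonneg (by positivity) (sub_nonneg.2 hyx))
      (fun i j => abs_sub_le_of_abs_deriv_le_div hC (hderiv i j) hy' hyx) _
  calc ‖spiral f x - spiral f y‖ ≤ ‖x - y‖ + n * (C / ‖y‖ * (‖x‖ - ‖y‖)) * ‖y‖ := by
        rw [hsplit]
        exact (norm_add_le _ _).trans (add_le_add hrot.le hdiff)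
    _ = ‖x - y‖ + n * C * (‖x‖ - ‖y‖) := by field_simp
    _ ≤ ‖x - y‖ + n * C * ‖x - y‖ := by gcongr; exact norm_sub_norm_le x y
    _ = (n * C + 1) * ‖x - y‖ := by ring


theorem spiral_biLipschitz {n : ℕ} (hn : 1 ≤ n) (C : ℝ) (hC : 0 ≤ C)
    (f : ℝ → Matrix (Fin n) (Fin n) ℝ)
    (hSO : ∀ t : ℝ, 0 < t → (f t)ᵀ * f t = 1 ∧ (f t).det = 1)
    (hderiv : ∀ (i j : Fin n) (t : ℝ), 0 < t →
      DifferentiableAt ℝ (fun s => f s i j) t ∧ |deriv (fun s => f s i j) t| ≤ C / t) :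
    ∀ x y : EuclideanSpace ℝ (Fin n),
      ((n : ℝ) * C + 1)⁻¹ * ‖x - y‖ ≤ ‖spiral f x - spiral f y‖ ∧
        ‖spiral f x - spiral f y‖ ≤ ((n : ℝ) * C + 1) * ‖x - y‖ := by
  have hf (t : ℝ) (ht : 0 < t) : (f t)ᵀ * f t = 1 := (hSO t ht).1
  refine fun x y => ⟨?_, norm_spiral_sub_spiral_le hC hf hderiv x y⟩
  have h := norm_spiral_sub_spiral_le (f := fun t => (f t)ᵀ) hC
    (fun t ht => (congrArg (· * (f t)ᵀ) (transpose_transpose (f t))).trans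
      (mul_eq_one_comm.1 (hf t ht)))
    (fun i j => hderiv j i) (spiral f x) (spiral f y)
  rw [spiral_transpose_spiral hf, spiral_transpose_spiral hf] at h
  exact (inv_mul_le_iff₀ (by positivity)).2 h
end

section
/- Let n ≥ 2 and let f : ℝ → Matrix (Fin n) (Fin n) ℝ satisfy f(t) ∈ SO(n) for every t > 0. If f(t) does not tend to the identity matrix as t → ∞ (i.e. ¬ Tendsto f atTop (𝓝 1)), then the spiral map φ_f is at unbounded distance from the identity: for every N > 0 there exists x ∈ ℝ^n with ‖φ_f(x) − x‖ > N. -/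
open Matrix

/-- On the sphere of radius `t`, the displacement of the spiral map controls the entries of
`f t - 1`, scaled by `t`. -/
theorem mul_abs_sub_one_apply_le_norm_spiral_sub {n : ℕ} (f : ℝ → Matrix (Fin n) (Fin n) ℝ)
    {t : ℝ} (ht : 0 ≤ t) (i j : Fin n) :
    t * |f t i j - (1 : Matrix (Fin n) (Fin n) ℝ) i j| ≤
      ‖spiral f (EuclideanSpace.single j t) - EuclideanSpace.single j t‖ := by
  refine le_of_eq_of_le ?_ (PiLp.norm_apply_le _ i)
  have h : (spiral f (EuclideanSpace.single j t) - EuclideanSpace.single j t) i =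
      t * (f t i j - (1 : Matrix (Fin n) (Fin n) ℝ) i j) := by
    have hsingle : EuclideanSpace.equiv (Fin n) ℝ (EuclideanSpace.single j t) = Pi.single j t :=
      rfl
    simp [spiral, hsingle, Matrix.one_apply, abs_of_nonneg ht, mul_sub]
  rw [h, Real.norm_eq_abs, abs_mul, abs_of_nonneg ht]

/-- If the spiral map is at bounded distance from the identity, then `f` tends to `1`. -/
theorem tendsto_one_of_norm_spiral_sub_le {n : ℕ} (f : ℝ → Matrix (Fin n) (Fin n) ℝ) (N : ℝ)
    (h : ∀ x : EuclideanSpace ℝ (Fin n), ‖spiral f x - x‖ ≤ N) :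
    Filter.Tendsto f Filter.atTop (nhds (1 : Matrix (Fin n) (Fin n) ℝ)) := by
  refine tendsto_pi_nhds.2 fun i => tendsto_pi_nhds.2 fun j => ?_
  refine tendsto_iff_norm_sub_tendsto_zero.2 ?_
  refine squeeze_zero' (Filter.Eventually.of_forall fun _ => norm_nonneg _) ?_
    ((tendsto_const_nhds (x := N)).div_atTop Filter.tendsto_id)
  filter_upwards [Filter.eventually_gt_atTop 0] with t ht
  rw [id, le_div_iff₀ ht, mul_comm, Real.norm_eq_abs]
  exact (mul_abs_sub_one_apply_le_norm_spiral_sub f ht.le i j).trans (h _)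

theorem spiral_unbounded_of_not_tendsto_one {n : ℕ} (hn : 2 ≤ n)
    (f : ℝ → Matrix (Fin n) (Fin n) ℝ)
    (hSO : ∀ t : ℝ, 0 < t → (f t)ᵀ * f t = 1 ∧ (f t).det = 1)
    (hnot : ¬ Filter.Tendsto f Filter.atTop (nhds (1 : Matrix (Fin n) (Fin n) ℝ))) :
    ∀ N : ℝ, 0 < N → ∃ x : EuclideanSpace ℝ (Fin n), ‖spiral f x - x‖ > N := by
  intro N _
  by_contra! h
  exact hnot (tendsto_one_of_norm_spiral_sub_le f N h)
end

section
/- Let n ≥ 1 and λ ≥ 1. Let S = {v ∈ ℝ^n : v ≠ 0} and let f : S → S be a bijection satisfying λ⁻¹‖x−y‖ ≤ ‖f(x)−f(y)‖ ≤ λ‖x−y‖ for all x, y ∈ S. Then the map g : ℝ^n → ℝ^n defined by g(0) = 0 and g(v) = f(v) for v ≠ 0 is a bijection of ℝ^n and is λ-bi-Lipschitz: λ⁻¹‖x−y‖ ≤ ‖g(x)−g(y)‖ ≤ λ‖x−y‖ for all x, y ∈ ℝ^n. -/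
open Classical

/-- Extension of a self-map of the punctured space `ℝⁿ \ {0}` to `ℝⁿ`, sending `0` to `0`. -/
noncomputable def extZero {n : ℕ}
    (f : {v : EuclideanSpace ℝ (Fin n) // v ≠ 0} → {v : EuclideanSpace ℝ (Fin n) // v ≠ 0}) :
    EuclideanSpace ℝ (Fin n) → EuclideanSpace ℝ (Fin n) :=
  fun v => if h : v = 0 then 0 else (f ⟨v, h⟩ : EuclideanSpace ℝ (Fin n))

/-- A bijective bi-Lipschitz self-map of the punctured space tends to `0` at `0`. -/
theorem tendsto_zero_of_bijective_biLipschitz {n : ℕ} (hn : 1 ≤ n) (lam : ℝ) (hlam : 1 ≤ lam)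
    (f : {v : EuclideanSpace ℝ (Fin n) // v ≠ 0} → {v : EuclideanSpace ℝ (Fin n) // v ≠ 0})
    (hsurj : Function.Surjective f)
    (hlow : ∀ x y : {v : EuclideanSpace ℝ (Fin n) // v ≠ 0},
      lam⁻¹ * ‖(x : EuclideanSpace ℝ (Fin n)) - (y : EuclideanSpace ℝ (Fin n))‖ ≤
        ‖(f x : EuclideanSpace ℝ (Fin n)) - (f y : EuclideanSpace ℝ (Fin n))‖)
    (hup : ∀ x y : {v : EuclideanSpace ℝ (Fin n) // v ≠ 0},
      ‖(f x : EuclideanSpace ℝ (Fin n)) - (f y : EuclideanSpace ℝ (Fin n))‖ ≤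
        lam * ‖(x : EuclideanSpace ℝ (Fin n)) - (y : EuclideanSpace ℝ (Fin n))‖) :
    (Filter.comap (Subtype.val : {v : EuclideanSpace ℝ (Fin n) // v ≠ 0} → _) (nhds 0)).NeBot ∧
      Filter.Tendsto (fun x => (f x : EuclideanSpace ℝ (Fin n)))
        (Filter.comap Subtype.val (nhds 0)) (nhds 0) := by
  have : Nonempty (Fin n) := ⟨⟨0, hn⟩⟩
  have hne : (Filter.comap (Subtype.val : {v : EuclideanSpace ℝ (Fin n) // v ≠ 0} → _)
      (nhds 0)).NeBot :=
    mem_closure_iff_comap_neBot.1 (dense_compl_singleton (0 : EuclideanSpace ℝ (Fin n)) 0)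
  refine ⟨hne, ?_⟩
  have hpos : 0 < lam := by linarith
  have hlip : LipschitzWith ⟨lam, hpos.le⟩ fun x => (f x : EuclideanSpace ℝ (Fin n)) :=
    LipschitzWith.of_dist_le_mul fun x y => by
      rw [Subtype.dist_eq, dist_eq_norm, dist_eq_norm]
      exact hup x y
  have hcauchy : Cauchy (Filter.comap
      (Subtype.val : {v : EuclideanSpace ℝ (Fin n) // v ≠ 0} → _) (nhds 0)) :=
    cauchy_nhds.comap le_rfl
  obtain ⟨L, hL⟩ := CompleteSpace.complete (hcauchy.map hlip.uniformContinuous)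
  have htend : Filter.Tendsto (fun x => (f x : EuclideanSpace ℝ (Fin n)))
      (Filter.comap Subtype.val (nhds 0)) (nhds L) := hL
  by_cases hL0 : L = 0
  · rwa [hL0] at htend
  obtain ⟨p, hp⟩ := hsurj ⟨L, hL0⟩
  have hle : lam⁻¹ * ‖(0 : EuclideanSpace ℝ (Fin n)) - p‖ ≤ ‖L - L‖ := by
    refine le_of_tendsto_of_tendsto' ((Filter.tendsto_comap.sub_const _).norm.const_mul _)
      (htend.sub_const L).norm fun x => ?_
    simpa [hp] using hlow x p
  have : 0 < lam⁻¹ * ‖(p : EuclideanSpace ℝ (Fin n))‖ :=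
    mul_pos (inv_pos.2 hpos) (norm_pos_iff.2 p.2)
  simp only [zero_sub, norm_neg, sub_self, norm_zero] at hle
  linarith

theorem extZero_bijective_biLipschitz {n : ℕ} (hn : 1 ≤ n) (lam : ℝ) (hlam : 1 ≤ lam)
    (f : {v : EuclideanSpace ℝ (Fin n) // v ≠ 0} → {v : EuclideanSpace ℝ (Fin n) // v ≠ 0})
    (hbij : Function.Bijective f)
    (hlow : ∀ x y : {v : EuclideanSpace ℝ (Fin n) // v ≠ 0},
      lam⁻¹ * ‖(x : EuclideanSpace ℝ (Fin n)) - (y : EuclideanSpace ℝ (Fin n))‖ ≤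
        ‖(f x : EuclideanSpace ℝ (Fin n)) - (f y : EuclideanSpace ℝ (Fin n))‖)
    (hup : ∀ x y : {v : EuclideanSpace ℝ (Fin n) // v ≠ 0},
      ‖(f x : EuclideanSpace ℝ (Fin n)) - (f y : EuclideanSpace ℝ (Fin n))‖ ≤
        lam * ‖(x : EuclideanSpace ℝ (Fin n)) - (y : EuclideanSpace ℝ (Fin n))‖) :
    Function.Bijective (extZero f) ∧
      ∀ x y : EuclideanSpace ℝ (Fin n),
        lam⁻¹ * ‖x - y‖ ≤ ‖extZero f x - extZero f y‖ ∧
          ‖extZero f x - extZero f y‖ ≤ lam * ‖x - y‖ := by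
  obtain ⟨hne, htend⟩ :=
    tendsto_zero_of_bijective_biLipschitz hn lam hlam f hbij.surjective hlow hup
  have hzero : extZero f 0 = 0 := by simp [extZero]
  have hval : ∀ v (h : v ≠ 0), extZero f v = f ⟨v, h⟩ := fun v h => by simp [extZero, h]
  have hbound : ∀ x, lam⁻¹ * ‖x‖ ≤ ‖extZero f x‖ ∧ ‖extZero f x‖ ≤ lam * ‖x‖ := by
    intro x
    by_cases hx : x = 0
    · simp [hx, hzero]
    rw [hval x hx]
    have h₁ := ((Filter.tendsto_comap (f := (Subtype.val :
      {v : EuclideanSpace ℝ (Fin n) // v ≠ 0} → _)) (x := nhds 0)).const_sub x).norm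
    have h₂ := (htend.const_sub (f ⟨x, hx⟩ : EuclideanSpace ℝ (Fin n))).norm
    rw [sub_zero] at h₁ h₂
    exact ⟨le_of_tendsto_of_tendsto' (h₁.const_mul _) h₂ fun y => hlow ⟨x, hx⟩ y,
      le_of_tendsto_of_tendsto' h₂ (h₁.const_mul _) fun y => hup ⟨x, hx⟩ y⟩
  have hlip : ∀ x y : EuclideanSpace ℝ (Fin n),
      lam⁻¹ * ‖x - y‖ ≤ ‖extZero f x - extZero f y‖ ∧
        ‖extZero f x - extZero f y‖ ≤ lam * ‖x - y‖ := by
    intro x y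
    by_cases hx : x = 0
    · simpa [hx, hzero] using hbound y
    by_cases hy : y = 0
    · simpa [hy, hzero] using hbound x
    rw [hval x hx, hval y hy]
    exact ⟨hlow ⟨x, hx⟩ ⟨y, hy⟩, hup ⟨x, hx⟩ ⟨y, hy⟩⟩
  refine ⟨⟨fun x y hxy => ?_, fun w => ?_⟩, hlip⟩
  · have h := (hlip x y).1
    rw [hxy, sub_self, norm_zero] at h
    have hinv : 0 < lam⁻¹ := inv_pos.2 (by linarith)
    exact sub_eq_zero.1 (norm_le_zero_iff.1 (nonpos_of_mul_nonpos_right h hinv))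
  · by_cases hw : w = 0
    · exact ⟨0, hzero.trans hw.symm⟩
    obtain ⟨v, hv⟩ := hbij.surjective ⟨w, hw⟩
    exact ⟨v, by rw [hval v v.2, hv]⟩
end

section
/- Let f : ℝ → ℝ, λ ≥ 1, ε ≥ 0, C ≥ 0, and suppose f is a (λ,ε)-quasi-isometric embedding whose range is C-dense in ℝ. Let k ≥ 1 and suppose there is M ≥ 0 such that |f^[k](x) − x| ≤ M for all x ∈ ℝ, where f^[k] denotes the k-fold iterate of f. Then there is M' ≥ 0 such that |f^[2](x) − x| ≤ M' for all x ∈ ℝ. (Consequently, the quasi-isometry group of ℝ contains no element of finite order k with 3 ≤ k < ∞.) -/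
/-- `g` expands large gaps in an order-preserving way, up to bounded error. -/
def CoarselyIncreasing (g : ℝ → ℝ) : Prop :=
  ∀ T : ℝ, ∃ B : ℝ, ∀ x y : ℝ, B ≤ y - x → T ≤ g y - g x

/-- `g` expands large gaps in an order-reversing way, up to bounded error. -/
def CoarselyDecreasing (g : ℝ → ℝ) : Prop :=
  ∀ T : ℝ, ∃ B : ℝ, ∀ x y : ℝ, B ≤ y - x → T ≤ g x - g y

theorem CoarselyIncreasing.comp {g h : ℝ → ℝ} (hg : CoarselyIncreasing g)
    (hh : CoarselyIncreasing h) : CoarselyIncreasing (g ∘ h) := fun T => by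
  obtain ⟨B, hB⟩ := hg T
  obtain ⟨B', hB'⟩ := hh B
  exact ⟨B', fun x y hxy => hB _ _ (hB' x y hxy)⟩

theorem CoarselyDecreasing.comp {g h : ℝ → ℝ} (hg : CoarselyDecreasing g)
    (hh : CoarselyDecreasing h) : CoarselyIncreasing (g ∘ h) := fun T => by
  obtain ⟨B, hB⟩ := hg T
  obtain ⟨B', hB'⟩ := hh B
  exact ⟨B', fun x y hxy => hB _ _ (hB' x y hxy)⟩

/-- A large displacement of a coarsely increasing map persists under iteration. -/
theorem CoarselyIncreasing.exists_le_iterate_displacement {g : ℝ → ℝ}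
    (hg : CoarselyIncreasing g) (n : ℕ) (T : ℝ) :
    ∃ B : ℝ, ∀ x : ℝ, (B ≤ g x - x → T ≤ g^[n + 1] x - x) ∧
      (B ≤ x - g x → T ≤ x - g^[n + 1] x) := by
  induction n with
  | zero => exact ⟨T, fun x => ⟨id, id⟩⟩
  | succ n ih =>
    obtain ⟨B, hB⟩ := ih
    obtain ⟨B', hB'⟩ := hg B
    refine ⟨max B' 0, fun x => ?_⟩
    rw [Function.iterate_succ_apply]
    refine ⟨fun hx => ?_, fun hx => ?_⟩
    · have h := (hB (g x)).1 (hB' _ _ ((le_max_left _ _).trans hx))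
      linarith [(le_max_right B' 0).trans hx]
    · have h := (hB (g x)).2 (hB' _ _ ((le_max_left _ _).trans hx))
      linarith [(le_max_right B' 0).trans hx]

/-- A coarsely increasing map with an iterate close to the identity is close to the identity. -/
theorem CoarselyIncreasing.exists_abs_sub_le {g : ℝ → ℝ} (hg : CoarselyIncreasing g)
    {k : ℕ} (hk : 1 ≤ k) {M : ℝ} (hM : ∀ x, |g^[k] x - x| ≤ M) :
    ∃ M' : ℝ, 0 ≤ M' ∧ ∀ x, |g x - x| ≤ M' := by
  obtain ⟨n, rfl⟩ := Nat.exists_eq_add_of_le' hk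
  obtain ⟨B, hB⟩ := hg.exists_le_iterate_displacement n (M + 1)
  refine ⟨max B 0, le_max_right _ _, fun x => (abs_le'.2 ⟨?_, ?_⟩).trans (le_max_left _ _)⟩
  · by_contra! h
    linarith [(hB x).1 h.le, (abs_le.1 (hM x)).2]
  · by_contra! h
    linarith [(hB x).2 (by linarith), (abs_le.1 (hM x)).1]

/-- A quasi-isometric embedding of the line is coarsely monotone. -/
theorem coarselyIncreasing_or_coarselyDecreasing {f : ℝ → ℝ} {lam eps : ℝ}
    (hlam : 1 ≤ lam) (heps : 0 ≤ eps)
    (hlow : ∀ x y : ℝ, lam⁻¹ * |x - y| - eps ≤ |f x - f y|)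
    (hup : ∀ x y : ℝ, |f x - f y| ≤ lam * |x - y| + eps) :
    CoarselyIncreasing f ∨ CoarselyDecreasing f := by
  have hlam0 : 0 < lam := by linarith
  have far (T x y : ℝ) (h : lam * (T + eps) ≤ y - x) : T ≤ |f y - f x| := by
    have h1 := hlow y x
    have h2 : T + eps ≤ lam⁻¹ * |y - x| := by
      rw [inv_mul_eq_div, le_div_iff₀ hlam0]
      linarith [le_abs_self (y - x)]
    linarith
  have near (x y : ℝ) (h : |x - y| ≤ 1) : |f x - f y| ≤ lam + eps := by
    have := mul_le_mul_of_nonneg_left h hlam0.le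
    linarith [hup x y]
  set R := lam * (2 * (lam + eps) + eps) with hR
  have sign_const : IsLocallyConstant
      (fun p : ℝ × ℝ => (0 < f (p.1 + (R + |p.2|)) - f p.1 : Prop)) := by
    rw [IsLocallyConstant.iff_eventually_eq]
    rintro ⟨a, t⟩
    filter_upwards [Metric.ball_mem_nhds (a, t) (show (0 : ℝ) < 1 / 2 by norm_num)]
    rintro ⟨b, s⟩ hp
    rw [Metric.mem_ball, Prod.dist_eq, max_lt_iff, Real.dist_eq, Real.dist_eq] at hp
    obtain ⟨hb, hs⟩ := hp
    dsimp only at hb hs ⊢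
    have h1 := abs_le.1 (near b a (by linarith))
    have h2 := abs_le.1 (near (b + (R + |s|)) (a + (R + |t|)) (by
      have := abs_abs_sub_abs_le_abs_sub s t
      rw [show b + (R + |s|) - (a + (R + |t|)) = (b - a) + (|s| - |t|) by ring]
      linarith [abs_add_le (b - a) (|s| - |t|)]))
    have h3 := far (2 * (lam + eps)) a (a + (R + |t|)) (by linarith [abs_nonneg t])
    have h4 := far (2 * (lam + eps)) b (b + (R + |s|)) (by linarith [abs_nonneg s])
    rw [le_abs'] at h3 h4
    refine propext ⟨fun h => ?_, fun h => ?_⟩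
    · rcases h3 with h3 | h3 <;> rcases h4 with h4 | h4 <;> linarith
    · rcases h3 with h3 | h3 <;> rcases h4 with h4 | h4 <;> linarith
  have key (x y : ℝ) (h : R ≤ y - x) : (0 < f y - f x) = (0 < f (0 + (R + |0|)) - f 0) := by
    have := sign_const.apply_eq_of_preconnectedSpace (x, y - x - R) (0, 0)
    dsimp only at this
    rwa [abs_of_nonneg (show 0 ≤ y - x - R by linarith),
      show x + (R + (y - x - R)) = y by ring] at this
  by_cases h0 : 0 < f (0 + (R + |0|)) - f 0
  · refine Or.inl fun T => ⟨max R (lam * (T + eps)), fun x y h => ?_⟩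
    have h1 := far T x y ((le_max_right _ _).trans h)
    have h2 : 0 < f y - f x := (key x y ((le_max_left _ _).trans h)).mpr h0
    rwa [abs_of_pos h2] at h1
  · refine Or.inr fun T => ⟨max R (lam * (T + eps)), fun x y h => ?_⟩
    have h1 := far T x y ((le_max_right _ _).trans h)
    have h2 : ¬ 0 < f y - f x := fun h' => h0 ((key x y ((le_max_left _ _).trans h)).mp h')
    rw [abs_of_nonpos (not_lt.1 h2)] at h1
    linarith

theorem no_higher_torsion_in_QI_of_line (f : ℝ → ℝ) (lam eps C : ℝ)
    (hlam : 1 ≤ lam) (heps : 0 ≤ eps) (hC : 0 ≤ C)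
    (hqie_low : ∀ x y : ℝ, lam⁻¹ * |x - y| - eps ≤ |f x - f y|)
    (hqie_up : ∀ x y : ℝ, |f x - f y| ≤ lam * |x - y| + eps)
    (hdense : ∀ z : ℝ, ∃ x : ℝ, |f x - z| ≤ C)
    (k : ℕ) (hk : 1 ≤ k) (M : ℝ) (hM : 0 ≤ M)
    (hiter : ∀ x : ℝ, |f^[k] x - x| ≤ M) :
    ∃ M' : ℝ, 0 ≤ M' ∧ ∀ x : ℝ, |f^[2] x - x| ≤ M' := by
  have hsq : CoarselyIncreasing f^[2] :=
    (coarselyIncreasing_or_coarselyDecreasing hlam heps hqie_low hqie_up).elim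
      (fun h => h.comp h) (fun h => h.comp h)
  refine hsq.exists_abs_sub_le hk (M := M + M) fun x => ?_
  rw [← Function.iterate_mul, mul_comm, Function.iterate_mul]
  exact (abs_sub_le _ (f^[k] x) _).trans (add_le_add (hiter _) (hiter _))
end
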